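/- The extended barcode space B̄ is the completion of the space B of finite barcodes in the bottleneck metric; in particular, B̄ is complete and separable (Polish). -/

import Mathlib

open scoped ENNReal

/-- `(a,b)` represents the half-open interval `[a,b)` with `0 ≤ a < b < ∞`. -/
def IsBarInterval (p : ℝ × ℝ) : Prop := 0 ≤ p.1 ∧ p.1 < p.2

/-- An element of the extended barcode space `B̄`: a multiset of intervals `[a,b)`
(recorded by its multiplicity function) such that for every `ε > 0` only finitely many
intervals (with multiplicity, each multiplicity being finite) have length `> ε`. -/
structure ExtBarcode where
  mult : ℝ × ℝ → ℕ
  isInterval : ∀ p, mult p ≠ 0 → IsBarInterval p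
  finite_long : ∀ ε : ℝ, 0 < ε → {p | mult p ≠ 0 ∧ ε < p.2 - p.1}.Finite

/-- The `d_∞` cost of matching two (possibly empty) intervals:
`d_∞([a,b),[c,d)) = max (|a-c|, |b-d|)`, `d_∞([a,b),∅) = (b-a)/2`, `d_∞(∅,∅) = 0`. -/
noncomputable def optCost : Option (ℝ × ℝ) → Option (ℝ × ℝ) → ℝ≥0∞
  | some p, some q => ENNReal.ofReal (max |p.1 - q.1| |p.2 - q.2|)
  | some p, none => ENNReal.ofReal ((p.2 - p.1) / 2)
  | none, some q => ENNReal.ofReal ((q.2 - q.1) / 2)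
  | none, none => 0

/-- A matching between two barcodes: a multiset of pairs from `(B₁ ∪ {∅}) × (B₂ ∪ {∅})`,
not containing `(∅,∅)`, in which each interval of `B₁` appears as a first coordinate
with its multiplicity, and each interval of `B₂` as a second coordinate with its
multiplicity. -/
structure BMatching (A B : ExtBarcode) where
  m : Option (ℝ × ℝ) × Option (ℝ × ℝ) → ℕ
  not_both_empty : m (none, none) = 0
  left : ∀ p : ℝ × ℝ, ∑' q : Option (ℝ × ℝ), (m (some p, q) : ℝ≥0∞) = A.mult p
  right : ∀ q : ℝ × ℝ, ∑' p : Option (ℝ × ℝ), (m (p, some q) : ℝ≥0∞) = B.mult q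

/-- The cost of a matching: the sup of `d_∞` over the pairs occurring in it. -/
noncomputable def BMatching.cost {A B : ExtBarcode} (C : BMatching A B) : ℝ≥0∞ :=
  ⨆ c ∈ {c | C.m c ≠ 0}, optCost c.1 c.2

/-- The bottleneck distance `d_B`: infimum of the costs of matchings. -/
noncomputable def bottleneckDist (A B : ExtBarcode) : ℝ≥0∞ :=
  ⨅ C : BMatching A B, C.cost

/-- Total number of intervals of a barcode, counted with multiplicity. -/
noncomputable def ExtBarcode.card (A : ExtBarcode) : ℝ≥0∞ := ∑' p : ℝ × ℝ, (A.mult p : ℝ≥0∞)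

/-- Membership in `B_N`: at most `N` intervals (counted with multiplicity). -/
def ExtBarcode.memBN (N : ℕ) (A : ExtBarcode) : Prop := A.card ≤ N

/-- A barcode is finite (lies in `B = ⋃ B_N`) if it has finitely many intervals. -/
def ExtBarcode.IsFinite (A : ExtBarcode) : Prop := {p | A.mult p ≠ 0}.Finite

/-- An indexed family of possibly empty intervals enumerates the barcode `A`. -/
def Represents {ι : Type*} (x : ι → Option (ℝ × ℝ)) (A : ExtBarcode) : Prop :=
  ∀ p, {i | x i = some p}.encard = A.mult p

/-- Two possibly empty intervals can be matched with cost at most `r`, either to each other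
or both to the empty interval. -/
def Near (r : ℝ≥0∞) (a b : Option (ℝ × ℝ)) : Prop :=
  optCost a b ≤ r ∨ optCost a none ≤ r ∧ optCost b none ≤ r

theorem optCost_some_some (p q : ℝ × ℝ) : optCost (some p) (some q) = edist p q := by
  simp only [optCost, edist_dist, Prod.dist_eq, Real.dist_eq]

theorem optCost_comm (a b : Option (ℝ × ℝ)) : optCost a b = optCost b a := by
  rcases a with _ | p <;> rcases b with _ | q
  · rfl
  · rfl
  · rfl
  · simp only [optCost_some_some, edist_comm]

theorem optCost_self (a : Option (ℝ × ℝ)) : optCost a a = 0 := by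
  cases a <;> simp [optCost]

theorem optCost_none_le (a b : Option (ℝ × ℝ)) :
    optCost a none ≤ optCost a b + optCost b none := by
  rcases a with _ | p <;> rcases b with _ | q
  · simp [optCost]
  · simp [optCost]
  · simp [optCost]
  · simp only [optCost]
    refine le_trans (ENNReal.ofReal_le_ofReal ?_) ENNReal.ofReal_add_le
    have h₁ := le_max_left |p.1 - q.1| |p.2 - q.2|
    have h₂ := le_max_right |p.1 - q.1| |p.2 - q.2|
    linarith [neg_abs_le (p.1 - q.1), le_abs_self (p.2 - q.2)]

theorem Near.symm {r : ℝ≥0∞} {a b : Option (ℝ × ℝ)} (h : Near r a b) : Near r b a := by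
  rcases h with h | h
  · exact .inl (optCost_comm a b ▸ h)
  · exact .inr h.symm

theorem Near.refl (r : ℝ≥0∞) (a : Option (ℝ × ℝ)) : Near r a a :=
  .inl (by simp [optCost_self])

theorem Near.optCost_none_le {r : ℝ≥0∞} {a b : Option (ℝ × ℝ)} (h : Near r a b) :
    optCost a none ≤ r + optCost b none := by
  rcases h with h | h
  · exact (_root_.optCost_none_le a b).trans (by gcongr)
  · exact h.1.trans le_self_add

theorem Near.trans {r s : ℝ≥0∞} {a b c : Option (ℝ × ℝ)} (hab : Near r a b)
    (hbc : Near s b c) : Near (r + s) a c := by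
  rcases hab with hab | hab <;> rcases hbc with hbc | hbc
  · rcases b with _ | b
    · exact .inr ⟨hab.trans le_self_add, (optCost_comm c none ▸ hbc).trans le_add_self⟩
    left
    rcases a with _ | a <;> rcases c with _ | c
    · simp [optCost]
    · rw [optCost_comm] at hab hbc ⊢
      rw [add_comm]
      exact (_root_.optCost_none_le _ (some b)).trans (add_le_add hbc hab)
    · exact (_root_.optCost_none_le _ (some b)).trans (add_le_add hab hbc)
    · rw [optCost_some_some] at *
      exact (edist_triangle _ _ _).trans (add_le_add hab hbc)
  · exact .inr ⟨(_root_.optCost_none_le _ b).trans (add_le_add hab hbc.1), hbc.2.trans le_add_self⟩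
  · refine .inr ⟨hab.1.trans le_self_add, ?_⟩
    rw [optCost_comm] at hbc
    rw [add_comm]
    exact (_root_.optCost_none_le _ b).trans (add_le_add hbc hab.2)
  · exact .inr ⟨hab.1.trans le_self_add, hbc.2.trans le_add_self⟩

theorem tsum_encard_fiber {α β : Type*} (s : Set α) (f : α → β) :
    ∑' b, (({i ∈ s | f i = b}.encard : ℕ∞) : ℝ≥0∞) = s.encard := by
  simp only [← ENNReal.tsum_set_one]
  rw [← (Equiv.sigmaFiberEquiv fun i : s => f i).tsum_eq, ENNReal.tsum_sigma']
  refine tsum_congr fun b => ?_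
  simp only [ENNReal.tsum_one]
  congr 1
  refine ENat.card_congr ⟨fun i => ⟨⟨i, i.2.1⟩, i.2.2⟩, fun i => ⟨i.1, i.1.2, i.2⟩, ?_, ?_⟩
  · intro i; rfl
  · intro i; rfl

theorem Represents.finite_fiber {ι : Type*} {x : ι → Option (ℝ × ℝ)} {A : ExtBarcode}
    (hx : Represents x A) (p : ℝ × ℝ) : {i | x i = some p}.Finite := by
  rw [← Set.encard_lt_top_iff, hx p]
  exact ENat.natCast_lt_top _

theorem Represents.mult_ne_zero_iff {ι : Type*} {x : ι → Option (ℝ × ℝ)} {A : ExtBarcode}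
    (hx : Represents x A) {p : ℝ × ℝ} : A.mult p ≠ 0 ↔ ∃ i, x i = some p := by
  rw [← Nat.cast_ne_zero (R := ℕ∞), ← hx p, Set.encard_ne_zero]
  rfl

theorem Represents.isBarInterval {ι : Type*} {x : ι → Option (ℝ × ℝ)} {A : ExtBarcode}
    (hx : Represents x A) {i : ι} {p : ℝ × ℝ} (hi : x i = some p) : IsBarInterval p :=
  A.isInterval p (hx.mult_ne_zero_iff.2 ⟨i, hi⟩)

theorem Represents.finite_long {ι : Type*} {x : ι → Option (ℝ × ℝ)} {A : ExtBarcode}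
    (hx : Represents x A) {δ : ℝ≥0∞} (hδ : 0 < δ) : {i | δ < optCost (x i) none}.Finite := by
  rcases eq_or_ne δ ⊤ with rfl | hδt
  · simp
  have hδ' : 0 < δ.toReal := ENNReal.toReal_pos hδ.ne' hδt
  refine ((A.finite_long δ.toReal hδ').biUnion fun p _ => hx.finite_fiber p).subset ?_
  intro i hi
  simp only [Set.mem_ofPred_eq] at hi
  rcases hxi : x i with _ | p
  · simp [hxi, optCost] at hi
  · rw [hxi, optCost, ENNReal.lt_ofReal_iff_toReal_lt hδt] at hi
    simp only [Set.mem_iUnion]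
    exact ⟨p, ⟨hx.mult_ne_zero_iff.2 ⟨i, hxi⟩, by linarith⟩, hxi⟩

theorem exists_represents {ι : Type*} (x : ι → Option (ℝ × ℝ))
    (hbar : ∀ i p, x i = some p → IsBarInterval p)
    (hfin : ∀ δ : ℝ≥0∞, 0 < δ → {i | δ < optCost (x i) none}.Finite) :
    ∃ A, Represents x A := by
  have hf (p) : {i | x i = some p}.Finite := by
    by_cases hp : IsBarInterval p
    · obtain ⟨δ, h0, hδ⟩ := exists_between
        (ENNReal.ofReal_pos.2 (half_pos (sub_pos.2 hp.2)) : 0 < ENNReal.ofReal ((p.2 - p.1) / 2))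
      refine (hfin δ h0).subset fun i (hi : x i = some p) => ?_
      simpa [hi, optCost] using hδ
    · convert Set.finite_empty
      exact Set.eq_empty_of_forall_notMem fun i hi => hp (hbar i p hi)
  have hne (p) (hp : {i | x i = some p}.ncard ≠ 0) : ∃ i, x i = some p :=
    (Set.nonempty_of_ncard_ne_zero hp)
  refine ⟨⟨fun p => {i | x i = some p}.ncard, fun p hp => ?_, fun ε hε => ?_⟩, fun p => ?_⟩
  · obtain ⟨i, hi⟩ := hne p hp
    exact hbar i p hi
  · have h := hfin (ENNReal.ofReal (ε / 2)) (by simpa using hε)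
    refine Set.Finite.of_finite_image (f := some) ((h.image x).subset ?_)
      (Option.some_injective _).injOn
    rintro _ ⟨p, ⟨hp, hlt⟩, rfl⟩
    obtain ⟨i, hi⟩ := hne p hp
    refine ⟨i, ?_, hi⟩
    simp only [Set.mem_ofPred_eq, hi, optCost]
    exact (ENNReal.ofReal_lt_ofReal_iff (by linarith)).2 (by linarith)
  · exact ((hf p).cast_ncard_eq).symm

theorem bottleneckDist_le_of_optCost_le {ι : Type*} {x y : ι → Option (ℝ × ℝ)}
    {A B : ExtBarcode} (hx : Represents x A) (hy : Represents y B) {r : ℝ≥0∞}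
    (h : ∀ i, optCost (x i) (y i) ≤ r) : bottleneckDist A B ≤ r := by
  classical
  let m (c : Option (ℝ × ℝ) × Option (ℝ × ℝ)) : ℕ :=
    if c = (none, none) then 0 else {i | x i = c.1 ∧ y i = c.2}.ncard
  have hl (p q) : (m (some p, q) : ℝ≥0∞) = {i ∈ {i | x i = some p} | y i = q}.encard := by
    rw [← ((hx.finite_fiber p).subset (Set.sep_subset _ _)).cast_ncard_eq]
    simp [m]
  have hr (p q) : (m (p, some q) : ℝ≥0∞) = {i ∈ {i | y i = some q} | x i = p}.encard := by
    rw [← ((hy.finite_fiber q).subset (Set.sep_subset _ _)).cast_ncard_eq]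
    simp [m, and_comm]
  let C : BMatching A B :=
    { m := m
      not_both_empty := by simp [m]
      left := fun p => by simp only [hl, tsum_encard_fiber, hx p]; simp
      right := fun q => by simp only [hr, tsum_encard_fiber, hy q]; simp }
  refine (iInf_le _ C).trans (iSup₂_le fun c hc => ?_)
  have hc' : m c ≠ 0 := hc
  simp only [m, ne_eq, ite_eq_left_iff, not_forall] at hc'
  obtain ⟨i, hi₁, hi₂⟩ := Set.nonempty_of_ncard_ne_zero hc'.2
  exact hi₁ ▸ hi₂ ▸ h i

theorem Represents.sum_elim {ι : Type*} {x : ι → Option (ℝ × ℝ)} {A : ExtBarcode}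
    (hx : Represents x A) (s : Set ι) [DecidablePred (· ∈ s)] :
    Represents (Sum.elim (fun i => if i ∈ s then x i else none)
      fun i => if i ∈ s then none else x i) A := by
  intro p
  rw [← hx p]
  refine Set.encard_congr ⟨fun i => ⟨Sum.elim id id i.1, ?_⟩,
    fun i => ⟨if i.1 ∈ s then .inl i.1 else .inr i.1, ?_⟩, ?_, ?_⟩
  · rcases i with ⟨i | i, hi⟩ <;> rw [Set.mem_ofPred_eq] at hi <;> by_cases h : i ∈ s <;> simp_all
  · by_cases h : i.1 ∈ s <;> simp [h] <;> exact i.2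
  · rintro ⟨i | i, hi⟩ <;> rw [Set.mem_ofPred_eq] at hi <;> by_cases h : i ∈ s <;> simp_all
  · rintro ⟨i, hi⟩
    by_cases h : i ∈ s <;> simp_all

theorem bottleneckDist_le_of_near {ι : Type*} {x y : ι → Option (ℝ × ℝ)}
    {A B : ExtBarcode} (hx : Represents x A) (hy : Represents y B) {r : ℝ≥0∞}
    (h : ∀ i, Near r (x i) (y i)) : bottleneckDist A B ≤ r := by
  classical
  let s := {i | optCost (x i) (y i) ≤ r}
  have hx' : Represents (Sum.elim x fun _ : ι => none) A := by
    simpa using hx.sum_elim Set.univ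
  refine bottleneckDist_le_of_optCost_le hx' (hy.sum_elim s) ?_
  rintro (i | i) <;> by_cases hi : i ∈ s
  · simpa [hi] using (show optCost (x i) (y i) ≤ r from hi)
  · simpa [hi] using ((h i).resolve_left hi).1
  · simp [hi, optCost]
  · simpa [hi, optCost_comm none] using ((h i).resolve_left hi).2

theorem ExtBarcode.countable_support (A : ExtBarcode) : {p | A.mult p ≠ 0}.Countable := by
  refine (Set.countable_iUnion fun n : ℕ =>
    (A.finite_long (1 / (n + 1)) Nat.one_div_pos_of_nat).countable).mono fun p hp => ?_
  obtain ⟨n, hn⟩ := exists_nat_one_div_lt (sub_pos.2 (A.isInterval p hp).2)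
  exact Set.mem_iUnion.2 ⟨n, hp, hn⟩

theorem BMatching.countable_support {A B : ExtBarcode} (C : BMatching A B) :
    {c | C.m c ≠ 0}.Countable := by
  refine (((A.countable_support.image some).insert none).prod
    ((B.countable_support.image some).insert none)).mono ?_
  rintro ⟨a, b⟩ (hc : C.m (a, b) ≠ 0)
  constructor
  · rcases a with _ | p
    · simp
    refine .inr ⟨p, fun h => hc ?_, rfl⟩
    simpa [h] using ENNReal.tsum_eq_zero.1 ((C.left p).trans (by simp [h])) b
  · rcases b with _ | q
    · simp
    refine .inr ⟨q, fun h => hc ?_, rfl⟩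
    simpa [h] using ENNReal.tsum_eq_zero.1 ((C.right q).trans (by simp [h])) a

theorem countable_sigma_fin {α : Type*} (m : α → ℕ) (h : {c | m c ≠ 0}.Countable) :
    Countable (Σ c, Fin (m c)) := by
  have := h.to_subtype
  refine Function.Injective.countable (β := {c | m c ≠ 0} × ℕ)
    (f := fun t => (⟨t.1, fun h0 => (Fin.cast h0 t.2).elim0⟩, t.2)) ?_
  rintro ⟨c, k⟩ ⟨d, l⟩ hcd
  simp only [Prod.mk.injEq, Subtype.mk.injEq] at hcd
  obtain ⟨rfl, hk⟩ := hcd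
  rw [Fin.ext hk]

theorem encard_sigma_fin_fiber {α : Type*} (m : α → ℕ) (c : α) :
    {t : Σ c, Fin (m c) | t.1 = c}.encard = m c := by
  have : {t : Σ c, Fin (m c) | t.1 = c} = Set.range (Sigma.mk c) := by
    ext ⟨d, k⟩
    constructor
    · rintro rfl
      exact ⟨k, rfl⟩
    · rintro ⟨l, h⟩
      exact (congrArg Sigma.fst h).symm
  rw [this, ← Set.image_univ, sigma_mk_injective.encard_image, Set.encard_univ]
  simp

theorem BMatching.represents_fst {A B : ExtBarcode} (C : BMatching A B) :
    Represents (fun t : Σ c, Fin (C.m c) => t.1.1) A := by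
  intro p
  rw [← ENat.toENNReal_inj, ← tsum_encard_fiber _ fun t : Σ c, Fin (C.m c) => t.1.2]
  rw [ENat.toENNReal_coe, ← C.left p]
  refine tsum_congr fun q => ?_
  rw [← ENat.toENNReal_coe, ← encard_sigma_fin_fiber C.m (some p, q)]
  congr 2 with t
  simp [Prod.ext_iff]

theorem BMatching.represents_snd {A B : ExtBarcode} (C : BMatching A B) :
    Represents (fun t : Σ c, Fin (C.m c) => t.1.2) B := by
  intro q
  rw [← ENat.toENNReal_inj, ← tsum_encard_fiber _ fun t : Σ c, Fin (C.m c) => t.1.1]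
  rw [ENat.toENNReal_coe, ← C.right q]
  refine tsum_congr fun p => ?_
  rw [← ENat.toENNReal_coe, ← encard_sigma_fin_fiber C.m (p, some q)]
  congr 2 with t
  simp [Prod.ext_iff, and_comm]

/-- Two enumerations of the same barcode differ by an injection, up to empty intervals. -/
theorem exists_injective_of_represents {ι τ : Type*} [Countable τ] {x : ι → Option (ℝ × ℝ)}
    {f : τ → Option (ℝ × ℝ)} {A : ExtBarcode} (hx : Represents x A) (hf : Represents f A)
    (hinf : {i | x i = none}.Infinite) :
    ∃ e : τ → ι, Function.Injective e ∧ (∀ t, x (e t) = f t) ∧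
      (∀ i, x i ≠ none → i ∈ Set.range e) ∧ (Set.range e)ᶜ.Infinite := by
  have := hinf.to_subtype
  obtain ⟨g₀, hg₀⟩ : ∃ g : {t // f t = none} → {i // x i = none},
      Function.Injective g ∧ (Set.range g)ᶜ.Infinite := by
    obtain ⟨k, hk⟩ := exists_injective_nat {t // f t = none}
    let N := Infinite.natEmbedding {i | x i = none}
    refine ⟨fun t => N (2 * k t), fun s t h => hk (by simpa using h), ?_⟩
    refine (Set.infinite_range_of_injective (f := fun n => N (2 * n + 1))
      fun m n h => by simpa using h).mono ?_
    rintro _ ⟨n, rfl⟩ ⟨t, ht⟩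
    have := N.injective ht
    omega
  have hg (p) : ∃ g : {t // f t = some p} → {i // x i = some p}, Function.Bijective g := by
    have h : {t | f t = some p}.encard = {i | x i = some p}.encard := by rw [hx p, hf p]
    have := (hf.finite_fiber p).to_subtype
    have := (hx.finite_fiber p).to_subtype
    obtain ⟨e⟩ := (Finite.card_eq (α := {t | f t = some p}) (β := {i | x i = some p})).1
      (congrArg ENat.toNat h)
    exact ⟨e, e.bijective⟩
  choose g₁ hg₁ using hg
  let g : ∀ o, {t // f t = o} → {i // x i = o}
    | none => g₀
    | some p => g₁ p
  have hginj : ∀ o, Function.Injective (g o)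
    | none => hg₀.1
    | some p => (hg₁ p).1
  have he (o t) (h : f t = o) : (g (f t) ⟨t, rfl⟩ : ι) = g o ⟨t, h⟩ := by subst h; rfl
  refine ⟨fun t => g (f t) ⟨t, rfl⟩, fun s t hst => ?_, fun t => (g (f t) ⟨t, rfl⟩).2,
    fun i hi => ?_, ?_⟩
  · have h : f s = f t := by
      rw [← (g (f s) ⟨s, rfl⟩).2, ← (g (f t) ⟨t, rfl⟩).2]
      exact congrArg x hst
    simp only [he _ _ h] at hst
    exact congrArg Subtype.val (hginj _ (Subtype.ext hst))
  · obtain ⟨p, hp⟩ := Option.ne_none_iff_exists'.1 hi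
    obtain ⟨⟨t, ht⟩, hti⟩ := (hg₁ p).2 ⟨i, hp⟩
    exact ⟨t, (he _ _ ht).trans (congrArg Subtype.val hti)⟩
  · refine (hg₀.2.image Subtype.val_injective.injOn).mono ?_
    rintro _ ⟨⟨i, hi⟩, hni, rfl⟩ ⟨t, ht⟩
    have h : f t = none := (g (f t) ⟨t, rfl⟩).2.symm.trans ((congrArg x ht).trans hi)
    refine hni ⟨⟨t, h⟩, Subtype.ext ?_⟩
    rw [← ht]
    exact (he _ _ h).symm

theorem exists_represents_near {ι : Type*} {x : ι → Option (ℝ × ℝ)} {A B : ExtBarcode}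
    (hx : Represents x A) (hinf : {i | x i = none}.Infinite) {r : ℝ≥0∞}
    (hr : bottleneckDist A B < r) :
    ∃ y : ι → Option (ℝ × ℝ), (Represents y B ∧ {i | y i = none}.Infinite) ∧
      ∀ i, Near r (x i) (y i) := by
  obtain ⟨C, hC⟩ := iInf_lt_iff.1 hr
  have := countable_sigma_fin C.m C.countable_support
  obtain ⟨e, he, hxe, hrange, hcompl⟩ :=
    exists_injective_of_represents hx C.represents_fst hinf
  have hout (i) (hi : i ∉ Set.range e) :
      Function.extend e (fun t => t.1.2) (fun _ => none) i = none :=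
    Function.extend_apply' _ _ _ hi
  refine ⟨Function.extend e (fun t => t.1.2) fun _ => none,
    ⟨fun q => ?_, hcompl.mono hout⟩, fun i => ?_⟩
  · rw [← C.represents_snd q, ← he.encard_image]
    refine congrArg Set.encard (Set.ext fun i => ?_)
    by_cases hi : i ∈ Set.range e
    · obtain ⟨t, rfl⟩ := hi
      simp [he.extend_apply, he.eq_iff]
    · simp only [Set.mem_ofPred_eq, hout i hi, reduceCtorEq, false_iff]
      rintro ⟨t, -, rfl⟩
      exact hi ⟨t, rfl⟩
  · by_cases hi : i ∈ Set.range e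
    · obtain ⟨t, rfl⟩ := hi
      left
      rw [he.extend_apply, hxe]
      have ht : C.m t.1 ≠ 0 := fun h0 => (Fin.cast h0 t.2).elim0
      exact (le_iSup₂ (f := fun c (_ : c ∈ {c | C.m c ≠ 0}) => optCost c.1 c.2) t.1 ht).trans
        hC.le
    · rw [hout i hi, not_not.1 (mt (hrange i) hi)]
      exact .refl _ _

theorem ExtBarcode.exists_enumeration (A : ExtBarcode) :
    ∃ x : (Σ p, Fin (A.mult p)) ⊕ ℕ → Option (ℝ × ℝ),
      Represents x A ∧ {i | x i = none}.Infinite := by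
  refine ⟨Sum.elim (fun t => some t.1) fun _ => none, fun p => ?_, ?_⟩
  · rw [← encard_sigma_fin_fiber A.mult p,
      ← (Sum.inl_injective (β := ℕ)).encard_image {t : Σ p, Fin (A.mult p) | t.1 = p}]
    congr 1
    ext (t | n) <;> simp
  · exact (Set.infinite_range_of_injective Sum.inr_injective).mono (by rintro _ ⟨n, rfl⟩; rfl)

theorem exists_near_limit (a : ℕ → Option (ℝ × ℝ))
    (hbar : ∀ k p, a k = some p → IsBarInterval p)
    (hnear : ∀ k, Near (1 / 2 ^ k) (a k) (a (k + 1))) :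
    ∃ l : Option (ℝ × ℝ), (∀ p, l = some p → IsBarInterval p) ∧
      ∀ k, Near (2 * (1 / 2 ^ k)) (a k) l := by
  have htwo (k : ℕ) : (2 : ℝ≥0∞) * (1 / 2 ^ (k + 1)) = 1 / 2 ^ k := by
    rw [pow_succ, one_div, ENNReal.mul_inv (by simp) (by simp), mul_comm, mul_assoc,
      ENNReal.inv_mul_cancel (by simp) (by simp), mul_one, one_div]
  by_cases h : ∀ k, optCost (a k) none ≤ 2 * (1 / 2 ^ k)
  · exact ⟨none, by simp, fun k => .inl (h k)⟩
  push Not at h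
  obtain ⟨k₀, hk₀⟩ := h
  have hlong (n : ℕ) : 2 * (1 / 2 ^ (k₀ + n)) < optCost (a (k₀ + n)) none := by
    induction n with
    | zero => exact hk₀
    | succ n ih =>
      by_contra! hle
      refine ih.not_ge ((hnear _).optCost_none_le.trans ?_)
      rw [two_mul]
      gcongr
      exact hle.trans_eq (htwo _)
  have hsome (n : ℕ) : ∃ p, a (k₀ + n) = some p := by
    refine Option.ne_none_iff_exists'.1 fun h => ?_
    simpa [h, optCost] using hlong n
  choose p hp using hsome
  have hedist (n : ℕ) : edist (p n) (p (n + 1)) ≤ 1 / 2 ^ k₀ / 2 ^ n := by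
    have h := (hnear (k₀ + n)).resolve_right fun h => (hlong n).not_ge
      (h.1.trans (le_mul_of_one_le_left' one_le_two))
    rw [add_assoc, hp n, hp (n + 1), optCost_some_some, pow_add] at h
    rwa [div_eq_mul_inv, div_eq_mul_inv, mul_assoc, ← ENNReal.mul_inv (by simp) (by simp)]
  obtain ⟨q, hq⟩ := cauchySeq_tendsto_of_complete
    (cauchySeq_of_edist_le_geometric_two _ (by simp) hedist)
  have hqd (n : ℕ) : optCost (a (k₀ + n)) (some q) ≤ 2 * (1 / 2 ^ (k₀ + n)) := by
    rw [hp n, optCost_some_some]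
    refine (edist_le_of_edist_le_geometric_two_of_tendsto _ hedist hq n).trans_eq ?_
    rw [pow_add, div_eq_mul_inv, div_eq_mul_inv, div_eq_mul_inv, mul_assoc, mul_assoc,
      ENNReal.mul_inv (by simp) (by simp)]
  refine ⟨some q, ?_, fun k => ?_⟩
  · rintro _ ⟨⟩
    constructor
    · exact ge_of_tendsto' ((continuous_fst.tendsto q).comp hq) fun n => (hbar _ _ (hp n)).1
    · by_contra! hle
      refine (hlong 0).not_ge ((optCost_none_le _ (some q)).trans ?_)
      have : optCost (some q) none = 0 := ENNReal.ofReal_eq_zero.2 (by linarith)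
      rw [this, add_zero]
      exact hqd 0
  · rcases le_total k₀ k with hk | hk
    · obtain ⟨n, rfl⟩ := Nat.exists_eq_add_of_le hk
      exact .inl (hqd n)
    · refine Nat.decreasingInduction' (P := fun k => Near (2 * (1 / 2 ^ k)) (a k) (some q))
        (fun k _ _ ih => ?_) hk (.inl (hqd 0))
      have := (hnear k).trans ih
      rwa [htwo, ← two_mul] at this

theorem exists_mul_one_div_two_pow_lt {c ε : ℝ≥0∞} (hc : c ≠ 0) (hc' : c ≠ ⊤) (hε : 0 < ε) :
    ∃ k : ℕ, c * (1 / 2 ^ k) < ε := by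
  obtain ⟨k, hk⟩ := ENNReal.exists_inv_two_pow_lt (ENNReal.div_pos hε.ne' hc').ne'
  refine ⟨k, ?_⟩
  rw [mul_comm, one_div, ENNReal.inv_pow]
  exact (ENNReal.lt_div_iff_mul_lt (.inl hc) (.inl hc')).1 hk

theorem exists_represents_limit {ι : Type*} (X : ℕ → ι → Option (ℝ × ℝ)) (v : ℕ → ExtBarcode)
    (hX : ∀ k, Represents (X k) (v k)) (hnear : ∀ k i, Near (1 / 2 ^ k) (X k i) (X (k + 1) i)) :
    ∃ (l : ι → Option (ℝ × ℝ)) (L : ExtBarcode), Represents l L ∧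
      ∀ k i, Near (2 * (1 / 2 ^ k)) (X k i) (l i) := by
  choose l hbar hl using fun i => exists_near_limit (fun k => X k i)
    (fun k p hp => (hX k).isBarInterval hp) fun k => hnear k i
  obtain ⟨L, hL⟩ := exists_represents l hbar fun δ hδ => by
    obtain ⟨k, hk⟩ := exists_mul_one_div_two_pow_lt (c := 2) (by simp) (by simp)
      (ENNReal.half_pos hδ.ne')
    refine ((hX k).finite_long (ENNReal.half_pos hδ.ne')).subset fun i (hi : δ < _) => ?_
    by_contra h
    refine hi.not_ge ((hl i k).symm.optCost_none_le.trans ?_)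
    exact (add_le_add hk.le (not_lt.1 h)).trans_eq (ENNReal.add_halves δ)
  exact ⟨l, L, hL, fun k i => hl i k⟩

theorem exists_rational_near {p : ℝ × ℝ} (hp : IsBarInterval p) {r : ℝ≥0∞} (hr : 0 < r) :
    ∃ q : ℚ × ℚ, IsBarInterval (q.1, q.2) ∧ Near r (some p) (some (q.1, q.2)) := by
  obtain ⟨s, hs, hsr⟩ := ENNReal.lt_iff_exists_nnreal_btwn.1 hr
  have hs' : (0 : ℝ) < s := by exact_mod_cast hs
  obtain ⟨a, ha, ha'⟩ := exists_rat_btwn (lt_min (lt_add_of_pos_right p.1 hs') hp.2)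
  obtain ⟨b, hb, hb'⟩ := exists_rat_btwn (lt_add_of_pos_right p.2 hs')
  obtain ⟨ha₁, ha₂⟩ := lt_min_iff.1 ha'
  refine ⟨(a, b), ⟨hp.1.trans ha.le, ha₂.trans hb⟩, .inl (le_trans ?_ hsr.le)⟩
  refine ENNReal.ofReal_le_of_le_toReal (max_le ?_ ?_)
  · rw [ENNReal.coe_toReal, abs_le]
    constructor <;> linarith
  · rw [ENNReal.coe_toReal, abs_le]
    constructor <;> linarith

/-- The finite barcodes whose intervals have rational endpoints. -/
def rationalBarcodes : Set ExtBarcode :=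
  {A | A.IsFinite ∧ ∀ p, A.mult p ≠ 0 → ∃ q : ℚ × ℚ, p = (↑q.1, ↑q.2)}

theorem ExtBarcode.mult_injective : Function.Injective ExtBarcode.mult := by
  rintro ⟨m, _, _⟩ ⟨n, _, _⟩ h
  simpa using h

theorem countable_rationalBarcodes : rationalBarcodes.Countable := by
  have hinj : Function.Injective fun q : ℚ × ℚ => ((q.1, q.2) : ℝ × ℝ) := by
    rintro ⟨a, b⟩ ⟨c, d⟩ h
    simpa using h
  let f (A : rationalBarcodes) : ℚ × ℚ →₀ ℕ :=
    Finsupp.ofSupportFinite (fun q => A.1.mult (q.1, q.2)) (A.2.1.preimage hinj.injOn)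
  refine Set.countable_coe_iff.1 (Function.Injective.countable (f := f) fun A B h => ?_)
  refine Subtype.ext (ExtBarcode.mult_injective (funext fun p => ?_))
  by_cases hp : ∃ q : ℚ × ℚ, p = (↑q.1, ↑q.2)
  · obtain ⟨q, rfl⟩ := hp
    exact DFunLike.congr_fun h q
  · rw [not_not.1 (mt (A.2.2 p) hp), not_not.1 (mt (B.2.2 p) hp)]

theorem exists_rationalBarcode_near (A : ExtBarcode) {ε : ℝ≥0∞} (hε : 0 < ε) :
    ∃ F ∈ rationalBarcodes, bottleneckDist A F < ε := by
  obtain ⟨r, hr, hrε⟩ := exists_between hε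
  obtain ⟨x, hx, -⟩ := A.exists_enumeration
  have key (i) : ∃ b : Option (ℚ × ℚ),
      (∀ q, b = some q → IsBarInterval (q.1, q.2)) ∧
      Near r (x i) (b.map fun q => ((q.1, q.2) : ℝ × ℝ)) ∧
      (optCost (x i) none ≤ r → b = none) := by
    by_cases h : optCost (x i) none ≤ r
    · exact ⟨none, by simp, .inl h, fun _ => rfl⟩
    rcases hxi : x i with _ | p
    · simp [hxi, optCost] at h
    obtain ⟨q, hq, hpq⟩ := exists_rational_near (hx.isBarInterval hxi) hr
    exact ⟨some q, by rintro _ ⟨⟩; exact hq, hpq, fun h' => absurd (hxi ▸ h') h⟩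
  choose b hbar hnear hnone using key
  have hfin : {i | b i ≠ none}.Finite :=
    (hx.finite_long hr).subset fun i hi => not_le.1 (mt (hnone i) hi)
  obtain ⟨F, hF⟩ := exists_represents (fun i => (b i).map fun q => ((q.1, q.2) : ℝ × ℝ))
    (fun i p hp => by
      obtain ⟨q, hq, rfl⟩ := Option.map_eq_some_iff.1 hp
      exact hbar i q hq)
    fun δ _ => hfin.subset fun i (hi : δ < _) h => by simp [h, optCost] at hi
  refine ⟨F, ⟨?_, fun p hp => ?_⟩, (bottleneckDist_le_of_near hx hF hnear).trans_lt hrε⟩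
  · refine Set.Finite.of_finite_image (f := some) ((hfin.image
      fun i => (b i).map fun q => ((q.1, q.2) : ℝ × ℝ)).subset ?_) (Option.some_injective _).injOn
    rintro _ ⟨p, hp, rfl⟩
    obtain ⟨i, hi⟩ := hF.mult_ne_zero_iff.1 hp
    exact ⟨i, fun h => by simp [h] at hi, hi⟩
  · obtain ⟨i, hi⟩ := hF.mult_ne_zero_iff.1 hp
    obtain ⟨q, -, rfl⟩ := Option.map_eq_some_iff.1 hi
    exact ⟨q, rfl⟩

theorem exists_bottleneck_limit (u : ℕ → ExtBarcode)
    (hu : ∀ ε : ℝ≥0∞, 0 < ε →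
      ∃ M : ℕ, ∀ m n : ℕ, M ≤ m → M ≤ n → bottleneckDist (u m) (u n) < ε) :
    ∃ L : ExtBarcode,
      ∀ ε : ℝ≥0∞, 0 < ε → ∃ M : ℕ, ∀ n : ℕ, M ≤ n → bottleneckDist (u n) L < ε := by
  choose M hM using fun k : ℕ => hu (1 / 2 ^ k) (ENNReal.div_pos one_ne_zero (by simp))
  let φ (k : ℕ) : ℕ := ∑ j ∈ Finset.range (k + 1), M j
  have hφ (k) : M k ≤ φ k :=
    Finset.single_le_sum (fun _ _ => Nat.zero_le _) (Finset.self_mem_range_succ k)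
  have hφ' (k) : M k ≤ φ (k + 1) := (hφ k).trans (by simp [φ, Finset.sum_range_succ _ (k + 1)])
  obtain ⟨x₀, hx₀⟩ := (u (φ 0)).exists_enumeration
  let S (k : ℕ) := {x : _ → Option (ℝ × ℝ) //
    Represents (ι := (Σ p, Fin ((u (φ 0)).mult p)) ⊕ ℕ) x (u (φ k)) ∧ {i | x i = none}.Infinite}
  have hstep (k) (x : S k) : ∃ y : S (k + 1), ∀ i, Near (1 / 2 ^ k) (x.1 i) (y.1 i) := by
    obtain ⟨y, hy, h⟩ := exists_represents_near x.2.1 x.2.2 (hM k _ _ (hφ k) (hφ' k))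
    exact ⟨⟨y, hy⟩, h⟩
  choose g hg using hstep
  let X (k : ℕ) : S k := Nat.rec ⟨x₀, hx₀⟩ g k
  obtain ⟨l, L, hL, hl⟩ := exists_represents_limit (fun k => (X k).1) (fun k => u (φ k))
    (fun k => (X k).2.1) fun k => hg k (X k)
  refine ⟨L, fun ε hε => ?_⟩
  obtain ⟨k, hk⟩ := exists_mul_one_div_two_pow_lt (c := 3) (by simp) (by simp) hε
  refine ⟨M k, fun n hn => ?_⟩
  obtain ⟨y, hy, h⟩ := exists_represents_near (X k).2.1 (X k).2.2 (hM k _ n (hφ k) hn)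
  refine (bottleneckDist_le_of_near hy.1 hL fun i => (h i).symm.trans (hl k i)).trans_lt
    (lt_of_eq_of_lt ?_ hk)
  ring

/-- the extended barcode space `B̄` is the completion of the space `B` of
finite barcodes in the bottleneck metric: `B̄` is complete, `B` is dense in `B̄`, and
`B̄` is separable (hence `B̄` is Polish). -/
theorem extBarcode_completion_polish :
    (∀ u : ℕ → ExtBarcode,
      (∀ ε : ℝ≥0∞, 0 < ε →
        ∃ M : ℕ, ∀ m n : ℕ, M ≤ m → M ≤ n → bottleneckDist (u m) (u n) < ε) →
      ∃ L : ExtBarcode,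
        ∀ ε : ℝ≥0∞, 0 < ε → ∃ M : ℕ, ∀ n : ℕ, M ≤ n → bottleneckDist (u n) L < ε) ∧
    (∀ A : ExtBarcode, ∀ ε : ℝ≥0∞, 0 < ε →
      ∃ F : ExtBarcode, F.IsFinite ∧ bottleneckDist A F < ε) ∧
    (∃ D : Set ExtBarcode, D.Countable ∧
      ∀ A : ExtBarcode, ∀ ε : ℝ≥0∞, 0 < ε → ∃ F ∈ D, bottleneckDist A F < ε) := by
  refine ⟨exists_bottleneck_limit, fun A ε hε => ?_, rationalBarcodes,
    countable_rationalBarcodes, fun A ε hε => exists_rationalBarcode_near A hε⟩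
  obtain ⟨F, hF, h⟩ := exists_rationalBarcode_near A hε
  exact ⟨F, hF.1, h⟩
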